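/- arXiv:1808.09987 — 11 statements merged into one kernel-verified Lean document; each statement's English description precedes it below -/
import Mathlib

section
/- Let f : [0,1]^n → ℝ be a nonnegative DR-submodular function. Then for every x* ∈ [0,1]^n and every x ∈ [0,1]^n, f(x* ∨ x) ≥ (1 − ‖x‖_∞)·f(x*), where (x* ∨ x)_i = max(x*_i, x_i) and ‖x‖_∞ = max_i |x_i|. -/
/-- A sequence with antitone increments up to index `N` lies above its chord from `0` to `N`. -/
theorem mul_sub_le_mul_sub_of_increments_antitone (a : ℕ → ℝ) (N : ℕ)
    (h : ∀ i j, i ≤ j → j < N → a (j + 1) - a j ≤ a (i + 1) - a i) (k : ℕ) (hk : k ≤ N) :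
    (k : ℝ) * (a N - a 0) ≤ N * (a k - a 0) := by
  have hinc : ∀ m, m < N → (m : ℝ) * (a (m + 1) - a m) ≤ a m - a 0 := by
    intro m
    induction m with
    | zero => intro _; simp
    | succ m ih =>
      intro hm
      have h1 := ih (by omega)
      have h2 := h m (m + 1) (by omega) hm
      have h3 := mul_le_mul_of_nonneg_left h2 (Nat.cast_nonneg (α := ℝ) (m + 1))
      push_cast at h3 ⊢
      linarith
  have hchord : ∀ m, k ≤ m → m ≤ N → (k : ℝ) * (a m - a 0) ≤ m * (a k - a 0) := by
    intro m hkm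
    induction m, hkm using Nat.le_induction with
    | base => intro _; exact le_rfl
    | succ m hkm ih =>
      intro hm
      have h1 := ih (by omega)
      have h2 := hinc k (by omega)
      have h3 := mul_le_mul_of_nonneg_left (h k m hkm (by omega)) (Nat.cast_nonneg (α := ℝ) k)
      push_cast
      linarith
  exact hchord N hk le_rfl

/-- A nonnegative function on `[0,1]` with antitone increments satisfies the concavity inequality
between its left endpoint and a point `m`, up to the nonnegative contribution of the right
endpoint. -/
theorem one_sub_mul_le_of_increments_antitone (g : ℝ → ℝ)
    (hg0 : ∀ t ∈ Set.Icc (0 : ℝ) 1, 0 ≤ g t)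
    (hg : ∀ s t δ : ℝ, 0 ≤ s → s ≤ t → 0 ≤ δ → t + δ ≤ 1 →
      g (t + δ) - g t ≤ g (s + δ) - g s)
    (m : ℝ) (hm0 : 0 < m) (hm1 : m ≤ 1) : (1 - m) * g 0 ≤ g m := by
  have key : ∀ k : ℕ, 0 < k → (k : ℝ) * (g 0 - g m - m * g 0) ≤ m * |g 0 - g m| := by
    intro k hk
    have hk' : (0 : ℝ) < k := by exact_mod_cast hk
    set N := ⌊(k : ℝ) / m⌋₊ with hN
    have hNle : (N : ℝ) * m ≤ k := (le_div_iff₀ hm0).1 (Nat.floor_le (by positivity))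
    have hNlt : (k : ℝ) < (N + 1) * m := (div_lt_iff₀ hm0).1 (Nat.lt_floor_add_one _)
    have hkN : k ≤ N := Nat.le_floor ((le_div_iff₀ hm0).2 (by nlinarith))
    have hNδ : (N : ℝ) * (m / k) ≤ 1 := by
      rw [← mul_div_assoc, div_le_one hk']; exact hNle
    have hδ : 0 ≤ m / k := by positivity
    have hchord := mul_sub_le_mul_sub_of_increments_antitone (fun j => g (j * (m / k))) N
      (by
        intro i j hij hj
        have hij' : (i : ℝ) ≤ j := by exact_mod_cast hij
        have hj' : (j : ℝ) + 1 ≤ N := by exact_mod_cast hj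
        have := hg (i * (m / k)) (j * (m / k)) (m / k) (by positivity) (by gcongr) hδ
          (by nlinarith)
        simpa only [Nat.cast_add, Nat.cast_one, add_mul, one_mul] using this) k hkN
    have hkm : (k : ℝ) * (m / k) = m := by field_simp
    simp only [hkm, Nat.cast_zero, zero_mul] at hchord
    have hlast : 0 ≤ g (N * (m / k)) := hg0 _ ⟨by positivity, hNδ⟩
    have hdrop : (N : ℝ) * (g 0 - g m) ≤ k * g 0 := by nlinarith
    have hdrop' := mul_le_mul_of_nonneg_left hdrop hm0.le
    have habs : (k - N * m) * (g 0 - g m) ≤ m * |g 0 - g m| :=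
      (mul_le_mul_of_nonneg_left (le_abs_self _) (by linarith)).trans
        (mul_le_mul_of_nonneg_right (by linarith) (abs_nonneg _))
    linarith
  by_contra! hlt
  have hpos : 0 < g 0 - g m - m * g 0 := by linarith
  obtain ⟨k, hk⟩ := exists_nat_gt (m * |g 0 - g m| / (g 0 - g m - m * g 0))
  have hk0 : (0 : ℝ) < k := lt_of_le_of_lt (by positivity) hk
  have := key k (by exact_mod_cast hk0)
  rw [div_lt_iff₀ hpos] at hk
  linarith

/-- The diminishing-returns inequality along coordinate directions extends to all nonnegative
directions. -/
theorem increment_le_of_coordinate_increment_le {n : ℕ} (f : (Fin n → ℝ) → ℝ)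
    (hDR : ∀ x y : Fin n → ℝ, (∀ i, x i ∈ Set.Icc (0:ℝ) 1) →
      (∀ i, y i ∈ Set.Icc (0:ℝ) 1) → x ≤ y → ∀ (i : Fin n) (δ : ℝ), 0 ≤ δ →
      (∀ j, (x + Pi.single i δ : Fin n → ℝ) j ∈ Set.Icc (0:ℝ) 1) →
      (∀ j, (y + Pi.single i δ : Fin n → ℝ) j ∈ Set.Icc (0:ℝ) 1) →
      f (y + Pi.single i δ) - f y ≤ f (x + Pi.single i δ) - f x)
    (x y v : Fin n → ℝ) (hx : ∀ i, 0 ≤ x i) (hxy : x ≤ y) (hv : ∀ i, 0 ≤ v i)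
    (hyv : ∀ i, y i + v i ≤ 1) :
    f (y + v) - f y ≤ f (x + v) - f x := by
  have hpartial : ∀ s : Finset (Fin n),
      f (y + s.piecewise v 0) - f y ≤ f (x + s.piecewise v 0) - f x := by
    intro s
    induction s using Finset.induction_on with
    | empty => simp
    | insert i s hi ih =>
      have hsplit : (insert i s).piecewise v 0 = s.piecewise v 0 + Pi.single i (v i) := by
        ext j
        by_cases hj : j = i
        · subst hj; simp [hi]
        · simp [Finset.piecewise, hj]
      have hbox : ∀ (s : Finset (Fin n)) (z : Fin n → ℝ), x ≤ z → z ≤ y →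
          ∀ j, (z + s.piecewise v 0) j ∈ Set.Icc (0 : ℝ) 1 := by
        intro s z hxz hzy j
        have h1 := hx j
        have h2 := hxz j
        have h3 := hzy j
        have h4 := hv j
        have h5 := hyv j
        by_cases hj : j ∈ s <;> simp only [Pi.add_apply, Finset.piecewise, hj, if_true, if_false,
          Pi.zero_apply] <;> constructor <;> linarith
      have hstep := hDR (x + s.piecewise v 0) (y + s.piecewise v 0) (hbox s x le_rfl hxy)
        (hbox s y hxy le_rfl) (by gcongr) i (v i) (hv i)
        (by rw [add_assoc, ← hsplit]; exact hbox _ x le_rfl hxy)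
        (by rw [add_assoc, ← hsplit]; exact hbox _ y hxy le_rfl)
      rw [add_assoc, add_assoc, ← hsplit] at hstep
      linarith
  simpa using hpartial Finset.univ


/-- For a nonnegative DR-submodular `f` on `[0,1]^n`, for every `x*` and `x`
in the box, `f(x* ⊔ x) ≥ (1 - ‖x‖_∞) f(x*)`.  Here vectors are elements of `Fin n → ℝ`,
whose norm is the sup norm, and `⊔` is the coordinatewise maximum. -/
theorem stmt_0 (n : ℕ) (f : (Fin n → ℝ) → ℝ)
    (hnonneg : ∀ x : Fin n → ℝ, (∀ i, x i ∈ Set.Icc (0:ℝ) 1) → 0 ≤ f x)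
    (hDR : ∀ x y : Fin n → ℝ, (∀ i, x i ∈ Set.Icc (0:ℝ) 1) →
      (∀ i, y i ∈ Set.Icc (0:ℝ) 1) → x ≤ y → ∀ (i : Fin n) (δ : ℝ), 0 ≤ δ →
      (∀ j, (x + Pi.single i δ : Fin n → ℝ) j ∈ Set.Icc (0:ℝ) 1) →
      (∀ j, (y + Pi.single i δ : Fin n → ℝ) j ∈ Set.Icc (0:ℝ) 1) →
      f (y + Pi.single i δ) - f y ≤ f (x + Pi.single i δ) - f x)
    (xstar x : Fin n → ℝ)
    (hxstar : ∀ i, xstar i ∈ Set.Icc (0:ℝ) 1)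
    (hx : ∀ i, x i ∈ Set.Icc (0:ℝ) 1) :
    (1 - ‖x‖) * f xstar ≤ f (xstar ⊔ x) := by
  rcases (norm_nonneg x).eq_or_lt with hm | hm
  · have hx0 : x = 0 := norm_eq_zero.1 hm.symm
    have hsup : xstar ⊔ x = xstar := sup_eq_left.2 fun i => by simpa [hx0] using (hxstar i).1
    simp [hsup, ← hm]
  have hxm : ∀ i, x i ≤ ‖x‖ := fun i => (le_abs_self _).trans (norm_le_pi_norm x i)
  have hm1 : ‖x‖ ≤ 1 := (pi_norm_le_iff_of_nonneg zero_le_one).2 fun i => by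
    rw [Real.norm_eq_abs, abs_of_nonneg (hx i).1]; exact (hx i).2
  set m := ‖x‖
  set w : Fin n → ℝ := fun i => (max (xstar i) (x i) - xstar i) / m with hw
  have hw0 : ∀ i, 0 ≤ w i := fun i => div_nonneg (sub_nonneg.2 (le_max_left _ _)) hm.le
  have hw1 : ∀ i, xstar i + w i ≤ 1 := by
    intro i
    have hle : w i ≤ 1 - xstar i := by
      rw [hw, div_le_iff₀ hm]
      have h1 := hxstar i
      rcases max_cases (xstar i) (x i) with ⟨h, _⟩ | ⟨h, _⟩ <;> rw [h] <;>
        nlinarith [h1.1, h1.2, hxm i]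
    linarith
  have hmain := one_sub_mul_le_of_increments_antitone (fun t => f (xstar + t • w))
    (by
      rintro t ⟨ht0, ht1⟩
      refine hnonneg _ fun i => ?_
      have h1 := hw0 i
      have h2 := hw1 i
      have h3 := (hxstar i).1
      simp only [Pi.add_apply, Pi.smul_apply, smul_eq_mul]
      constructor <;> nlinarith)
    (by
      intro s t δ hs hst hδ htδ
      have := increment_le_of_coordinate_increment_le f hDR (xstar + s • w) (xstar + t • w)
        (δ • w)
        (fun i => add_nonneg (hxstar i).1 (mul_nonneg hs (hw0 i)))
        (fun i => add_le_add_right (mul_le_mul_of_nonneg_right hst (hw0 i)) _)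
        (fun i => mul_nonneg hδ (hw0 i))
        (fun i => by
          have h1 := hw0 i
          have h2 := hw1 i
          simp only [Pi.add_apply, Pi.smul_apply, smul_eq_mul]
          nlinarith)
      simpa only [add_smul, add_assoc] using this)
    m hm hm1
  have hend : xstar + m • w = xstar ⊔ x := by
    ext i
    simp only [hw, Pi.add_apply, Pi.smul_apply, smul_eq_mul, Pi.sup_apply]
    field_simp
    ring
  simpa [hend] using hmain
end

section
/- Let f : ℝ^n → ℝ be differentiable. Then f restricted to [0,1]^n is DR-submodular if and only if the gradient of f is antitone on [0,1]^n: for all x ≤ y coordinatewise in [0,1]^n, ∇f(x) ≥ ∇f(y) coordinatewise. -/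
/-- The `i`-th coordinate of the gradient of `f : ℝ^n → ℝ` at `x`. -/
noncomputable def fgrad {n : ℕ} (f : (Fin n → ℝ) → ℝ) (x : Fin n → ℝ) (i : Fin n) : ℝ :=
  fderiv ℝ f x (Pi.single i 1)

theorem hasDerivAt_add_single {n : ℕ} {f : (Fin n → ℝ) → ℝ} (hf : Differentiable ℝ f)
    (x : Fin n → ℝ) (i : Fin n) (t : ℝ) :
    HasDerivAt (fun s : ℝ => f (x + Pi.single i s)) (fgrad f (x + Pi.single i t) i) t :=
  (hf _).hasFDerivAt.comp_hasDerivAt t ((hasDerivAt_single i t).const_add x)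

theorem add_single_mem_Icc {n : ℕ} {x : Fin n → ℝ} (hx : ∀ j, x j ∈ Set.Icc (0 : ℝ) 1)
    {i : Fin n} {t : ℝ} (ht : x i + t ∈ Set.Icc (0 : ℝ) 1) (j : Fin n) :
    (x + Pi.single i t : Fin n → ℝ) j ∈ Set.Icc (0 : ℝ) 1 := by
  rcases eq_or_ne j i with rfl | h
  · simpa using ht
  · simpa [h] using hx j

/-- The gain of `f` from `x + t eᵢ` to `y + t eᵢ`, as a function of `t`. -/
def shiftGap {n : ℕ} (f : (Fin n → ℝ) → ℝ) (x y : Fin n → ℝ) (i : Fin n) (t : ℝ) : ℝ :=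
  f (y + Pi.single i t) - f (x + Pi.single i t)

theorem hasDerivAt_shiftGap {n : ℕ} {f : (Fin n → ℝ) → ℝ} (hf : Differentiable ℝ f)
    (x y : Fin n → ℝ) (i : Fin n) (t : ℝ) :
    HasDerivAt (shiftGap f x y i)
      (fgrad f (y + Pi.single i t) i - fgrad f (x + Pi.single i t) i) t :=
  (hasDerivAt_add_single hf y i t).sub (hasDerivAt_add_single hf x i t)

/-- If the gap is antitone on a nondegenerate interval of shifts that contains `0`,
then the partial derivatives at the end points are ordered. -/
theorem fgrad_le_of_antitoneOn_shiftGap {n : ℕ} {f : (Fin n → ℝ) → ℝ} (hf : Differentiable ℝ f)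
    {x y : Fin n → ℝ} {i : Fin n} {a b : ℝ} (hab : a < b) (h0 : (0 : ℝ) ∈ Set.Icc a b)
    (h : AntitoneOn (shiftGap f x y i) (Set.Icc a b)) : fgrad f y i ≤ fgrad f x i := by
  have hd := (hasDerivAt_shiftGap hf x y i 0).hasDerivWithinAt.derivWithin
    (uniqueDiffOn_Icc hab 0 h0)
  have hn := h.derivWithin_nonpos (x := 0)
  rw [hd] at hn
  simpa using hn

/-- A differentiable `f : ℝ^n → ℝ` is DR-submodular on `[0,1]^n`
(in the sense of diminishing returns along coordinates) if and only if its gradient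
is antitone on `[0,1]^n`. -/
theorem stmt_2 (n : ℕ) (f : (Fin n → ℝ) → ℝ) (hf : Differentiable ℝ f) :
    (∀ x y : Fin n → ℝ, (∀ i, x i ∈ Set.Icc (0:ℝ) 1) →
      (∀ i, y i ∈ Set.Icc (0:ℝ) 1) → x ≤ y → ∀ (i : Fin n) (δ : ℝ), 0 ≤ δ →
      (∀ j, (x + Pi.single i δ : Fin n → ℝ) j ∈ Set.Icc (0:ℝ) 1) →
      (∀ j, (y + Pi.single i δ : Fin n → ℝ) j ∈ Set.Icc (0:ℝ) 1) →
      f (y + Pi.single i δ) - f y ≤ f (x + Pi.single i δ) - f x)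
    ↔
    (∀ x y : Fin n → ℝ, (∀ i, x i ∈ Set.Icc (0:ℝ) 1) →
      (∀ i, y i ∈ Set.Icc (0:ℝ) 1) → x ≤ y →
      ∀ i, fgrad f y i ≤ fgrad f x i) := by
  constructor
  · intro hdr
    have key : ∀ x y : Fin n → ℝ, (∀ i, x i ∈ Set.Icc (0:ℝ) 1) →
        (∀ i, y i ∈ Set.Icc (0:ℝ) 1) → x ≤ y → ∀ i, y i - x i < 1 →
        fgrad f y i ≤ fgrad f x i := by
      intro x y hx hy hxy i hi
      have hxyi := hxy i
      refine fgrad_le_of_antitoneOn_shiftGap hf (a := -x i) (b := 1 - y i) (by linarith)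
        ⟨by linarith [(hx i).1], by linarith [(hy i).2]⟩ ?_
      intro s hs t ht hst
      have mem : ∀ r ∈ Set.Icc (-x i) (1 - y i),
          (∀ j, (x + Pi.single i r : Fin n → ℝ) j ∈ Set.Icc (0:ℝ) 1) ∧
          (∀ j, (y + Pi.single i r : Fin n → ℝ) j ∈ Set.Icc (0:ℝ) 1) := fun r hr =>
        ⟨add_single_mem_Icc hx ⟨by linarith [hr.1], by linarith [hr.2]⟩,
          add_single_mem_Icc hy ⟨by linarith [hr.1], by linarith [hr.2]⟩⟩
      have shift : ∀ z : Fin n → ℝ,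
          z + Pi.single i s + Pi.single i (t - s) = z + Pi.single i t := fun z => by
        rw [add_assoc, ← Pi.single_add, add_sub_cancel]
      have := hdr (x + Pi.single i s) (y + Pi.single i s) (mem s hs).1 (mem s hs).2
        (by gcongr) i (t - s) (by linarith)
        (by rw [shift]; exact (mem t ht).1) (by rw [shift]; exact (mem t ht).2)
      rw [shift, shift] at this
      unfold shiftGap
      linarith
    intro x y hx hy hxy i
    rcases lt_or_ge (y i - x i) 1 with h | h
    · exact key x y hx hy hxy i h
    have hxi : x i = 0 := by linarith [(hx i).1, (hy i).2]
    have hyi : y i = 1 := by linarith [(hx i).1, (hy i).2]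
    have hz : ∀ j, (y + Pi.single i (-1 / 2) : Fin n → ℝ) j ∈ Set.Icc (0:ℝ) 1 :=
      add_single_mem_Icc hy (by rw [hyi]; constructor <;> norm_num)
    have hzi : (y + Pi.single i (-1 / 2) : Fin n → ℝ) i = 1 / 2 := by
      rw [Pi.add_apply, Pi.single_eq_same, hyi]; norm_num
    refine (key _ y hz hy (fun j => ?_) i (by rw [hzi, hyi]; norm_num)).trans
      (key x _ hx hz (fun j => ?_) i (by rw [hzi, hxi]; norm_num))
    · rcases eq_or_ne j i with rfl | hj
      · rw [hzi, hyi]; norm_num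
      · simp [hj]
    · rcases eq_or_ne j i with rfl | hj
      · rw [hzi, hxi]; norm_num
      · simpa [hj] using hxy j
  · intro hg x y hx hy hxy i δ hδ _ hyδ
    have hyi : y i + δ ≤ 1 := by simpa using (hyδ i).2
    have hanti : AntitoneOn (shiftGap f x y i) (Set.Icc 0 δ) := by
      refine antitoneOn_of_deriv_nonpos (convex_Icc 0 δ)
        (fun t _ => (hasDerivAt_shiftGap hf x y i t).continuousAt.continuousWithinAt)
        (fun t _ => (hasDerivAt_shiftGap hf x y i t).differentiableAt.differentiableWithinAt)
        fun t ht => ?_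
      obtain ⟨h0, h1⟩ := interior_subset ht
      have hxyi := hxy i
      rw [(hasDerivAt_shiftGap hf x y i t).deriv, sub_nonpos]
      exact hg _ _
        (add_single_mem_Icc hx ⟨by linarith [(hx i).1], by linarith⟩)
        (add_single_mem_Icc hy ⟨by linarith [(hy i).1], by linarith⟩) (by gcongr) i
    have := hanti (Set.left_mem_Icc.2 hδ) (Set.right_mem_Icc.2 hδ) hδ
    simp only [shiftGap, Pi.single_zero, add_zero] at this
    linarith
end

section
/- Let g be a submodular set function on the ground set [n], i.e., g(A ∪ B) + g(A ∩ B) ≤ g(A) + g(B) for all A, B ⊆ [n]. Then its multilinear extension G(x) = Σ_{S ⊆ [n]} g(S) · Π_{i ∈ S} x_i · Π_{i ∉ S} (1 − x_i) is DR-submodular on [0,1]^n: for all x ≤ y coordinatewise in [0,1]^n, all i ∈ [n], and all δ ≥ 0 with x + δe_i ∈ [0,1]^n and y + δe_i ∈ [0,1]^n, G(x + δe_i) − G(x) ≥ G(y + δe_i) − G(y). -/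
/-- The multilinear extension of a set function `g` on ground set `Fin n`. -/
noncomputable def multilinearExt {n : ℕ} (g : Finset (Fin n) → ℝ) (x : Fin n → ℝ) : ℝ :=
  ∑ S : Finset (Fin n), g S * (∏ i ∈ S, x i) * ∏ i ∈ Sᶜ, (1 - x i)

/-- Splitting the multilinear extension along the coordinate `i`. -/
theorem multilinearExt_eq_sum_erase {n : ℕ} (g : Finset (Fin n) → ℝ) (x : Fin n → ℝ)
    (i : Fin n) :
    multilinearExt g x = ∑ S ∈ (Finset.univ.erase i).powerset,
      ((1 - x i) * g S + x i * g (insert i S)) *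
        ((∏ j ∈ S, x j) * ∏ j ∈ Sᶜ.erase i, (1 - x j)) := by
  have h : (Finset.univ : Finset (Finset (Fin n))) =
      (insert i (Finset.univ.erase i)).powerset := by
    rw [Finset.insert_erase (Finset.mem_univ i), Finset.powerset_univ]
  unfold multilinearExt
  rw [h, Finset.sum_powerset_insert (Finset.notMem_erase i _), ← Finset.sum_add_distrib]
  refine Finset.sum_congr rfl fun S hS => ?_
  have hi : i ∉ S := fun hi => Finset.notMem_erase i _ (Finset.mem_powerset.1 hS hi)
  rw [Finset.prod_insert hi, Finset.compl_insert,
    ← Finset.mul_prod_erase Sᶜ (fun j => 1 - x j) (Finset.mem_compl.2 hi)]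
  ring

/-- The multilinear extension is affine in each coordinate. -/
theorem multilinearExt_update_sub {n : ℕ} (g : Finset (Fin n) → ℝ) (x : Fin n → ℝ)
    (i : Fin n) (t : ℝ) :
    multilinearExt g (Function.update x i t) - multilinearExt g x =
      (t - x i) * multilinearExt (fun S => g (insert i S) - g (S.erase i)) x := by
  rw [multilinearExt_eq_sum_erase g _ i, multilinearExt_eq_sum_erase g x i,
    multilinearExt_eq_sum_erase _ x i, ← Finset.sum_sub_distrib, Finset.mul_sum]
  refine Finset.sum_congr rfl fun S hS => ?_
  have hi : i ∉ S := fun hi => Finset.notMem_erase i _ (Finset.mem_powerset.1 hS hi)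
  have h₁ : ∏ j ∈ S, Function.update x i t j = ∏ j ∈ S, x j :=
    Finset.prod_congr rfl fun j hj =>
      Function.update_of_ne (ne_of_mem_of_not_mem hj hi) _ _
  have h₂ : ∏ j ∈ Sᶜ.erase i, (1 - Function.update x i t j) = ∏ j ∈ Sᶜ.erase i, (1 - x j) :=
    Finset.prod_congr rfl fun j hj => by
      rw [Function.update_of_ne (Finset.ne_of_mem_erase hj)]
  rw [h₁, h₂, Function.update_self, Finset.insert_idem, Finset.erase_insert hi,
    Finset.erase_eq_of_notMem hi]
  ring

theorem multilinearExt_nonpos {n : ℕ} {g : Finset (Fin n) → ℝ} (hg : ∀ S, g S ≤ 0)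
    {x : Fin n → ℝ} (hx : ∀ i, x i ∈ Set.Icc (0:ℝ) 1) : multilinearExt g x ≤ 0 :=
  Finset.sum_nonpos fun S _ =>
    mul_nonpos_of_nonpos_of_nonneg
      (mul_nonpos_of_nonpos_of_nonneg (hg S) (Finset.prod_nonneg fun j _ => (hx j).1))
      (Finset.prod_nonneg fun j _ => sub_nonneg.2 (hx j).2)

/-- The multilinear extension of an antitone set function is antitone on `[0,1]^n`. -/
theorem multilinearExt_le_of_antitone {n : ℕ} {g : Finset (Fin n) → ℝ} (hg : Antitone g)
    {x y : Fin n → ℝ} (hx : ∀ i, x i ∈ Set.Icc (0:ℝ) 1) (hy : ∀ i, y i ∈ Set.Icc (0:ℝ) 1)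
    (hxy : x ≤ y) : multilinearExt g y ≤ multilinearExt g x := by
  suffices h : ∀ s : Finset (Fin n),
      multilinearExt g (s.piecewise y x) ≤ multilinearExt g x by
    simpa using h Finset.univ
  intro s
  induction s using Finset.induction_on with
  | empty => simp
  | insert j s hj ih =>
    have hz : ∀ k, s.piecewise y x k ∈ Set.Icc (0:ℝ) 1 := fun k => by
      by_cases hk : k ∈ s
      · simpa [hk] using hy k
      · simpa [hk] using hx k
    have h := multilinearExt_update_sub g (s.piecewise y x) j (y j)
    rw [← Finset.piecewise_insert, Finset.piecewise_eq_of_notMem _ _ _ hj] at h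
    have hD := multilinearExt_nonpos (g := fun S => g (insert j S) - g (S.erase j))
      (fun S => sub_nonpos.2
        (hg ((Finset.erase_subset j S).trans (Finset.subset_insert j S)))) hz
    have := mul_nonpos_of_nonneg_of_nonpos (sub_nonneg.2 (hxy j)) hD
    linarith

/-- The marginal contributions of a submodular set function are decreasing. -/
theorem antitone_insert_sub_erase {α : Type*} [DecidableEq α] {g : Finset α → ℝ}
    (hsub : ∀ A B : Finset α, g (A ∪ B) + g (A ∩ B) ≤ g A + g B) (i : α) :
    Antitone fun S => g (insert i S) - g (S.erase i) := by
  intro S T hST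
  have h := hsub (insert i S) (T.erase i)
  have h₁ : insert i S ∪ T.erase i = insert i T := by
    ext a
    have := @hST a
    simp only [Finset.mem_union, Finset.mem_insert, Finset.mem_erase]
    tauto
  have h₂ : insert i S ∩ T.erase i = S.erase i := by
    ext a
    have := @hST a
    simp only [Finset.mem_inter, Finset.mem_insert, Finset.mem_erase]
    tauto
  rw [h₁, h₂] at h
  dsimp only
  linarith

/-- The multilinear extension of a submodular set function is DR-submodular
on `[0,1]^n`. -/
theorem stmt_3 (n : ℕ) (g : Finset (Fin n) → ℝ)
    (hsub : ∀ A B : Finset (Fin n), g (A ∪ B) + g (A ∩ B) ≤ g A + g B)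
    (x y : Fin n → ℝ)
    (hx : ∀ i, x i ∈ Set.Icc (0:ℝ) 1) (hy : ∀ i, y i ∈ Set.Icc (0:ℝ) 1)
    (hxy : x ≤ y) (i : Fin n) (δ : ℝ) (hδ : 0 ≤ δ)
    (hxδ : ∀ j, (x + Pi.single i δ : Fin n → ℝ) j ∈ Set.Icc (0:ℝ) 1)
    (hyδ : ∀ j, (y + Pi.single i δ : Fin n → ℝ) j ∈ Set.Icc (0:ℝ) 1) :
    multilinearExt g (y + Pi.single i δ) - multilinearExt g y ≤
      multilinearExt g (x + Pi.single i δ) - multilinearExt g x := by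
  have key : ∀ z : Fin n → ℝ, multilinearExt g (z + Pi.single i δ) - multilinearExt g z =
      δ * multilinearExt (fun S => g (insert i S) - g (S.erase i)) z := fun z => by
    have hz : z + Pi.single i δ = Function.update z i (z i + δ) := by
      ext j
      rcases eq_or_ne j i with rfl | hj
      · simp
      · simp [hj]
    rw [hz, multilinearExt_update_sub, add_sub_cancel_left]
  rw [key, key]
  exact mul_le_mul_of_nonneg_left
    (multilinearExt_le_of_antitone (antitone_insert_sub_erase hsub i) hx hy hxy) hδ
end

section
/- Let η > 0, let A ∈ ℝ^{m×n} have nonnegative entries, and let x, d ∈ ℝ^n be nonnegative vectors such that d_i > 0 only if x_i > 0, and such that (1/η)·‖Ad‖_∞ ≤ 1/2. Then smax_η(A(x + d)) ≤ smax_η(Ax) + ⟨Aᵀ∇smax_η(Ax), d⟩ + ‖Ax‖_∞ · (1/η) · Σ_{i : x_i > 0} (Aᵀ∇smax_η(Ax))_i · d_i²/x_i. -/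
/-- The softmax function `smax_η(z) = η ln(∑_j e^{z_j/η})`. -/
noncomputable def smax {m : ℕ} (η : ℝ) (z : Fin m → ℝ) : ℝ :=
  η * Real.log (∑ j, Real.exp (z j / η))

/-- The `j`-th coordinate of the gradient of the softmax function. -/
noncomputable def smaxGrad {m : ℕ} (η : ℝ) (z : Fin m → ℝ) (j : Fin m) : ℝ :=
  Real.exp (z j / η) / ∑ l, Real.exp (z l / η)

/-- Second-order upper bound for the softmax along increments of size at most `η`. -/
theorem smax_add_le {m : ℕ} {η : ℝ} (hη : 0 < η) (z w : Fin m → ℝ)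
    (hw : ∀ j, |w j / η| ≤ 1) :
    smax η (z + w) ≤ smax η z + ∑ j, smaxGrad η z j * w j
      + 1 / η * ∑ j, smaxGrad η z j * w j ^ 2 := by
  rcases isEmpty_or_nonempty (Fin m) with hm | hm
  · simp [smax]
  have hS : 0 < ∑ l, Real.exp (z l / η) :=
    Finset.sum_pos (fun _ _ => Real.exp_pos _) Finset.univ_nonempty
  have hT : 0 < ∑ l, Real.exp ((z + w) l / η) :=
    Finset.sum_pos (fun _ _ => Real.exp_pos _) Finset.univ_nonempty
  have hlog := Real.log_le_sub_one_of_pos (div_pos hT hS)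
  rw [Real.log_div hT.ne' hS.ne'] at hlog
  have hratio : (∑ l, Real.exp ((z + w) l / η)) / (∑ l, Real.exp (z l / η)) - 1
      ≤ ∑ j, smaxGrad η z j * (w j / η + (w j / η) ^ 2) := by
    have hone : ∑ j, smaxGrad η z j = 1 := by
      simp only [smaxGrad]
      rw [← Finset.sum_div, div_self hS.ne']
    rw [← hone, Finset.sum_div, ← Finset.sum_sub_distrib]
    refine Finset.sum_le_sum fun j _ => ?_
    have hexp := (abs_le.1 (Real.abs_exp_sub_one_sub_id_le (hw j))).2
    have hp : 0 ≤ smaxGrad η z j := div_nonneg (Real.exp_pos _).le hS.le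
    have hsplit : Real.exp ((z + w) j / η) / (∑ l, Real.exp (z l / η))
        = smaxGrad η z j * Real.exp (w j / η) := by
      rw [Pi.add_apply, add_div, Real.exp_add, smaxGrad]
      ring
    rw [hsplit]
    nlinarith [mul_le_mul_of_nonneg_left hexp hp]
  have hscale : η * ∑ j, smaxGrad η z j * (w j / η + (w j / η) ^ 2)
      = ∑ j, smaxGrad η z j * w j + 1 / η * ∑ j, smaxGrad η z j * w j ^ 2 := by
    rw [Finset.mul_sum, Finset.mul_sum, ← Finset.sum_add_distrib]
    refine Finset.sum_congr rfl fun j _ => ?_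
    field_simp
  have h := mul_le_mul_of_nonneg_left (hlog.trans hratio) hη.le
  rw [hscale, mul_sub] at h
  simp only [smax]
  linarith

/-- Weighted Cauchy-Schwarz inequality for a matrix with nonnegative entries. -/
theorem mulVec_sq_le {m n : ℕ} {A : Matrix (Fin m) (Fin n) ℝ} (hA : ∀ j i, 0 ≤ A j i)
    {x d : Fin n → ℝ} (hx : 0 ≤ x) (hsupp : ∀ i, x i = 0 → d i = 0) (j : Fin m) :
    A.mulVec d j ^ 2 ≤ ‖A.mulVec x‖ * ∑ i, A j i * (d i ^ 2 / x i) := by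
  have hcs : A.mulVec d j ^ 2 ≤ A.mulVec x j * ∑ i, A j i * (d i ^ 2 / x i) := by
    simp only [Matrix.mulVec, dotProduct]
    refine Finset.sum_sq_le_sum_mul_sum_of_sq_le_mul _
      (fun i _ => mul_nonneg (hA j i) (hx i))
      (fun i _ => mul_nonneg (hA j i) (div_nonneg (sq_nonneg _) (hx i))) fun i _ => ?_
    by_cases hxi : x i = 0
    · simp [hxi, hsupp i hxi]
    · exact le_of_eq (by field_simp)
  refine hcs.trans (mul_le_mul_of_nonneg_right ?_ ?_)
  · exact (Real.le_norm_self _).trans (norm_le_pi_norm _ j)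
  · exact Finset.sum_nonneg fun i _ => mul_nonneg (hA j i) (div_nonneg (sq_nonneg _) (hx i))

open Classical in
/-- second-order upper bound for the increase of the softmax potential under
a nonnegative update `d` supported on the support of `x`, with `(1/η)‖Ad‖_∞ ≤ 1/2`.
Norms on `Fin m → ℝ` are sup norms. -/
theorem stmt_4 (m n : ℕ) (η : ℝ) (hη : 0 < η)
    (A : Matrix (Fin m) (Fin n) ℝ) (hA : ∀ j i, 0 ≤ A j i)
    (x d : Fin n → ℝ) (hx : 0 ≤ x) (hd : 0 ≤ d)
    (hsupp : ∀ i, 0 < d i → 0 < x i)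
    (hstep : (1 / η) * ‖A.mulVec d‖ ≤ 1 / 2) :
    smax η (A.mulVec (x + d)) ≤ smax η (A.mulVec x)
      + (∑ i, (∑ j, A j i * smaxGrad η (A.mulVec x) j) * d i)
      + ‖A.mulVec x‖ * (1 / η) *
          ∑ i ∈ Finset.univ.filter (fun i => 0 < x i),
            (∑ j, A j i * smaxGrad η (A.mulVec x) j) * (d i ^ 2 / x i) := by
  have hzero : ∀ i, x i = 0 → d i = 0 := fun i hi =>
    le_antisymm (not_lt.1 fun h => (hsupp i h).ne' hi) (hd i)
  have hw : ∀ j, |A.mulVec d j / η| ≤ 1 := fun j => by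
    rw [abs_div, abs_of_pos hη, div_eq_inv_mul, ← one_div]
    have hj := mul_le_mul_of_nonneg_left (norm_le_pi_norm (A.mulVec d) j) (one_div_pos.2 hη).le
    rw [Real.norm_eq_abs] at hj
    linarith
  have hswap : ∀ v : Fin n → ℝ, ∑ i, (∑ j, A j i * smaxGrad η (A.mulVec x) j) * v i
      = ∑ j, smaxGrad η (A.mulVec x) j * ∑ i, A j i * v i := fun v => by
    simp only [Finset.sum_mul, Finset.mul_sum]
    rw [Finset.sum_comm]
    exact Finset.sum_congr rfl fun _ _ => Finset.sum_congr rfl fun _ _ => by ring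
  have hfilter : ∑ i ∈ Finset.univ.filter (fun i => 0 < x i),
      (∑ j, A j i * smaxGrad η (A.mulVec x) j) * (d i ^ 2 / x i)
      = ∑ i, (∑ j, A j i * smaxGrad η (A.mulVec x) j) * (d i ^ 2 / x i) := by
    refine Finset.sum_filter_of_ne fun i _ hi => (hx i).lt_of_ne' fun (h : x i = 0) => hi ?_
    rw [h, div_zero, mul_zero]
  have hquad : ∑ j, smaxGrad η (A.mulVec x) j * A.mulVec d j ^ 2
      ≤ ‖A.mulVec x‖ * ∑ j, smaxGrad η (A.mulVec x) j * ∑ i, A j i * (d i ^ 2 / x i) := by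
    rw [Finset.mul_sum]
    refine Finset.sum_le_sum fun j _ => ?_
    rw [mul_left_comm]
    exact mul_le_mul_of_nonneg_left (mulVec_sq_le hA hx hzero j)
      (div_nonneg (Real.exp_pos _).le (Finset.sum_nonneg fun _ _ => (Real.exp_pos _).le))
  rw [hfilter, hswap, hswap fun i => d i ^ 2 / x i, Matrix.mulVec_add]
  refine (smax_add_le hη _ _ hw).trans (add_le_add le_rfl ?_)
  rw [mul_comm ‖A.mulVec x‖ (1 / η), mul_assoc]
  exact mul_le_mul_of_nonneg_left hquad (one_div_pos.2 hη).le
end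

section
/- Let η ∈ (0, 1/2], let A ∈ ℝ^{m×n} have nonnegative entries, let x ∈ ℝ^n be nonnegative with ‖Ax‖_∞ ≤ 1, let λ > 0, and let c ∈ ℝ^n be nonnegative. Define the diagonal matrix M by M_ii = max(1 − λ·(Aᵀ∇smax_η(Ax))_i / c_i, 0) when c_i > 0 and M_ii = 0 when c_i = 0, and set d = η·M·x. Assume (1/η)·‖Ad‖_∞ ≤ 1/2. Then smax_η(A(x + d)) − smax_η(Ax) ≤ (1/λ)·⟨c, d⟩. -/
theorem smax_add_sub_le {m : ℕ} {η : ℝ} (hη : 0 < η) (z w : Fin m → ℝ) :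
    smax η (z + w) - smax η z ≤ η * ∑ j, smaxGrad η z j * (Real.exp (w j / η) - 1) := by
  rcases isEmpty_or_nonempty (Fin m) with h | h
  · simp [smax]
  have hpos : ∀ v : Fin m → ℝ, 0 < ∑ j, Real.exp (v j / η) := fun v =>
    Finset.sum_pos (fun j _ => Real.exp_pos _) Finset.univ_nonempty
  have hz := hpos z
  have hzw := hpos (z + w)
  unfold smax
  rw [← mul_sub, ← Real.log_div hzw.ne' hz.ne']
  refine mul_le_mul_of_nonneg_left
    ((Real.log_le_sub_one_of_pos (div_pos hzw hz)).trans_eq ?_) hη.le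
  rw [div_sub_one hz.ne', ← Finset.sum_sub_distrib, Finset.sum_div]
  refine Finset.sum_congr rfl fun j _ => ?_
  rw [smaxGrad, Pi.add_apply, add_div, Real.exp_add]
  ring

theorem smaxGrad_nonneg {m : ℕ} (η : ℝ) (z : Fin m → ℝ) (j : Fin m) : 0 ≤ smaxGrad η z j := by
  unfold smaxGrad
  positivity

theorem exp_sub_one_le_add_sq {t : ℝ} (ht : |t| ≤ 1) : Real.exp t - 1 ≤ t + t ^ 2 := by
  linarith [(abs_le.mp (Real.abs_exp_sub_one_sub_id_le ht)).2]

/-- Weighted Cauchy–Schwarz for weights of total mass at most one. -/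
theorem sq_sum_mul_le_sum_mul_sq {ι : Type*} (s : Finset ι) (w f : ι → ℝ)
    (hw : ∀ i ∈ s, 0 ≤ w i) (hw1 : ∑ i ∈ s, w i ≤ 1) :
    (∑ i ∈ s, w i * f i) ^ 2 ≤ ∑ i ∈ s, w i * f i ^ 2 := by
  have hf : ∀ i ∈ s, 0 ≤ w i * f i ^ 2 := fun i hi => mul_nonneg (hw i hi) (sq_nonneg _)
  calc (∑ i ∈ s, w i * f i) ^ 2 ≤ (∑ i ∈ s, w i) * ∑ i ∈ s, w i * f i ^ 2 :=
        Finset.sum_sq_le_sum_mul_sum_of_sq_le_mul s hw hf fun i _ => le_of_eq (by ring)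
    _ ≤ ∑ i ∈ s, w i * f i ^ 2 := mul_le_of_le_one_left (Finset.sum_nonneg hf) hw1


/-- with `M` the diagonal matrix whose entries are
`M_ii = max(1 - λ (Aᵀ∇smax_η(Ax))_i / c_i, 0)` (and `0` when `c_i = 0`) and `d = η M x`,
assuming `(1/η)‖Ad‖_∞ ≤ 1/2`, the softmax increase is at most `⟨c, d⟩/λ`. -/
theorem stmt_6 (m n : ℕ) (η : ℝ) (hη0 : 0 < η) (hη : η ≤ 1 / 2)
    (A : Matrix (Fin m) (Fin n) ℝ) (hA : ∀ j i, 0 ≤ A j i)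
    (x : Fin n → ℝ) (hx : 0 ≤ x) (hAx : ‖A.mulVec x‖ ≤ 1)
    (lam : ℝ) (hlam : 0 < lam)
    (c : Fin n → ℝ) (hc : 0 ≤ c)
    (M : Fin n → ℝ)
    (hM : ∀ i, (0 < c i →
        M i = max (1 - lam * (∑ j, A j i * smaxGrad η (A.mulVec x) j) / c i) 0)
      ∧ (c i = 0 → M i = 0))
    (d : Fin n → ℝ) (hd : d = fun i => η * (M i * x i))
    (hstep : (1 / η) * ‖A.mulVec d‖ ≤ 1 / 2) :
    smax η (A.mulVec (x + d)) - smax η (A.mulVec x) ≤ (1 / lam) * ∑ i, c i * d i := by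
  set p := smaxGrad η (A.mulVec x)
  have hp0 : ∀ j, 0 ≤ p j := smaxGrad_nonneg η _
  have hd_eq : ∀ j, A.mulVec d j / η = ∑ i, A j i * x i * M i := fun j => by
    rw [hd, div_eq_iff hη0.ne', Finset.sum_mul, Matrix.mulVec, dotProduct]
    exact Finset.sum_congr rfl fun i _ => by ring
  have hexp : ∀ j, Real.exp (A.mulVec d j / η) - 1
      ≤ ∑ i, A j i * (x i * (M i + M i ^ 2)) := fun j => by
    have hsmall : |A.mulVec d j / η| ≤ 1 := by
      rw [abs_div, abs_of_pos hη0, div_eq_inv_mul, ← one_div]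
      have := mul_le_mul_of_nonneg_left (norm_le_pi_norm (A.mulVec d) j) (one_div_pos.2 hη0).le
      rw [Real.norm_eq_abs] at this
      linarith
    have hmass : ∑ i, A j i * x i ≤ 1 :=
      ((le_abs_self _).trans (norm_le_pi_norm (A.mulVec x) j)).trans hAx
    have hsq := sq_sum_mul_le_sum_mul_sq Finset.univ (fun i => A j i * x i) M
      (fun i _ => mul_nonneg (hA j i) (hx i)) hmass
    calc Real.exp (A.mulVec d j / η) - 1
        ≤ A.mulVec d j / η + (A.mulVec d j / η) ^ 2 := exp_sub_one_le_add_sq hsmall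
      _ ≤ ∑ i, A j i * x i * M i + ∑ i, A j i * x i * M i ^ 2 := by
        rw [hd_eq]
        gcongr
      _ = ∑ i, A j i * (x i * (M i + M i ^ 2)) := by
        rw [← Finset.sum_add_distrib]
        exact Finset.sum_congr rfl fun i _ => by ring
  have hterm : ∀ i, lam * ((∑ j, A j i * p j) * (x i * (M i + M i ^ 2)))
      ≤ c i * (M i * x i) := fun i => by
    rcases (hc i).eq_or_lt with hi | hi
    · simp [(hM i).2 hi.symm]
    · have hMi := (hM i).1 hi
      rcases le_total (1 - lam * (∑ j, A j i * p j) / c i) 0 with h | h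
      · simp [hMi, max_eq_right h]
      · rw [max_eq_left h] at hMi
        have hM0 : 0 ≤ M i := hMi ▸ h
        have hgrad : lam * (∑ j, A j i * p j) = c i * (1 - M i) := by
          have hci : c i ≠ 0 := hi.ne'
          rw [hMi]
          field_simp
          ring
        calc lam * ((∑ j, A j i * p j) * (x i * (M i + M i ^ 2)))
            = c i * (M i * x i) - c i * x i * M i ^ 3 := by
              rw [← mul_assoc, hgrad]
              ring
          _ ≤ c i * (M i * x i) :=
              sub_le_self _ (mul_nonneg (mul_nonneg hi.le (hx i)) (pow_nonneg hM0 3))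
  rw [Matrix.mulVec_add]
  calc smax η (A.mulVec x + A.mulVec d) - smax η (A.mulVec x)
      ≤ η * ∑ j, p j * (Real.exp (A.mulVec d j / η) - 1) := smax_add_sub_le hη0 _ _
    _ ≤ η * ∑ j, p j * ∑ i, A j i * (x i * (M i + M i ^ 2)) := by
      gcongr with j
      · exact hp0 j
      · exact hexp j
    _ = η * ∑ i, (∑ j, A j i * p j) * (x i * (M i + M i ^ 2)) := by
      simp_rw [Finset.mul_sum, Finset.sum_mul, Finset.mul_sum]
      rw [Finset.sum_comm]
      exact Finset.sum_congr rfl fun i _ => Finset.sum_congr rfl fun j _ => by ring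
    _ ≤ η * ∑ i, (1 / lam) * (c i * (M i * x i)) := by
      refine mul_le_mul_of_nonneg_left (Finset.sum_le_sum fun i _ => ?_) hη0.le
      rw [one_div, le_inv_mul_iff₀ hlam]
      exact hterm i
    _ = (1 / lam) * ∑ i, c i * d i := by
      rw [hd, ← Finset.mul_sum, mul_left_comm, Finset.mul_sum]
      congr 1
      exact Finset.sum_congr rfl fun i _ => by ring
end

section
/- Let P be the polymatroid associated with a normalized, monotone, submodular function r on a finite ground set V. Let a, b, c ∈ ℝ^V with a ≥ 0, c ≥ 0, a + c ∈ P, b ∈ P, and a ≤ b coordinatewise. Then there exists a vector d ∈ ℝ^V such that 0 ≤ d ≤ c, b + d ∈ P, and ‖c − d‖₁ ≤ ‖b − a‖₁, where ‖·‖₁ denotes the ℓ₁ norm. -/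
/-- Two sets that are tight for a vector satisfying all rank constraints have a tight union. -/
lemma sum_union_eq_of_tight {V : Type*} [DecidableEq V] {r : Finset V → ℝ}
    (hrsub : ∀ S T, r (S ∪ T) + r (S ∩ T) ≤ r S + r T) {x : V → ℝ}
    (hx : ∀ S, ∑ i ∈ S, x i ≤ r S) {S T : Finset V}
    (hS : ∑ i ∈ S, x i = r S) (hT : ∑ i ∈ T, x i = r T) :
    ∑ i ∈ S ∪ T, x i = r (S ∪ T) := by
  have h := Finset.sum_union_inter (s₁ := S) (s₂ := T) (f := x)
  linarith [hrsub S T, hx (S ∪ T), hx (S ∩ T)]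

/-- If every element of `J` lies in a tight set, then `J` is contained in a tight set. -/
lemma exists_tight_superset {V : Type*} [DecidableEq V] {r : Finset V → ℝ} (hr0 : r ∅ = 0)
    (hrsub : ∀ S T, r (S ∪ T) + r (S ∩ T) ≤ r S + r T) {x : V → ℝ}
    (hx : ∀ S, ∑ i ∈ S, x i ≤ r S) (J : Finset V)
    (hJ : ∀ i ∈ J, ∃ S, i ∈ S ∧ ∑ k ∈ S, x k = r S) :
    ∃ T, J ⊆ T ∧ ∑ i ∈ T, x i = r T := by
  induction J using Finset.induction_on with
  | empty => exact ⟨∅, subset_rfl, by simp [hr0]⟩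
  | insert j J _ ih =>
    obtain ⟨T, hJT, hT⟩ := ih fun i hi => hJ i (Finset.mem_insert_of_mem hi)
    obtain ⟨S, hjS, hS⟩ := hJ j (Finset.mem_insert_self j J)
    refine ⟨S ∪ T, Finset.insert_subset (Finset.mem_union_left T hjS)
      (hJT.trans Finset.subset_union_right), sum_union_eq_of_tight hrsub hx hS hT⟩

/-- A coordinate lying in no tight set can be increased by a positive amount. -/
lemma exists_pos_add_single_le {V : Type*} [Fintype V] [DecidableEq V] {r : Finset V → ℝ}
    {x : V → ℝ} (hx : ∀ S, ∑ i ∈ S, x i ≤ r S) (j : V)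
    (hj : ∀ S, j ∈ S → ∑ i ∈ S, x i ≠ r S) :
    ∃ ε > 0, ∀ δ ≤ ε, ∀ S, ∑ i ∈ S, (x i + Pi.single (M := fun _ => ℝ) j δ i) ≤ r S := by
  obtain ⟨S₀, hS₀, hmin⟩ := (Finset.univ.filter (j ∈ ·)).exists_min_image
    (fun S => r S - ∑ i ∈ S, x i) ⟨{j}, by simp⟩
  refine ⟨r S₀ - ∑ i ∈ S₀, x i,
    sub_pos.2 ((hx S₀).lt_of_ne (hj S₀ (by simpa using hS₀))), fun δ hδ S => ?_⟩
  rw [Finset.sum_add_distrib, Finset.sum_pi_single']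
  split_ifs with hjS
  · linarith [hmin S (by simpa using hjS)]
  · simpa using hx S

/-- Among the vectors `d` with `0 ≤ d ≤ c` and `b + d` satisfying all rank constraints there is
one with maximal coordinate sum. -/
lemma exists_max_sum {V : Type*} [Fintype V] {r : Finset V → ℝ} {b c : V → ℝ} (hc : 0 ≤ c)
    (hb : ∀ S, ∑ i ∈ S, b i ≤ r S) :
    ∃ d : V → ℝ, (0 ≤ d ∧ d ≤ c ∧ ∀ S, ∑ i ∈ S, (b i + d i) ≤ r S) ∧
      ∀ e : V → ℝ, 0 ≤ e → e ≤ c → (∀ S, ∑ i ∈ S, (b i + e i) ≤ r S) →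
        ∑ i, e i ≤ ∑ i, d i := by
  have hclosed : IsClosed {d : V → ℝ | ∀ S, ∑ i ∈ S, (b i + d i) ≤ r S} := by
    simp only [Set.ofPred_forall]
    exact isClosed_iInter fun S => isClosed_le (by fun_prop) continuous_const
  obtain ⟨d, ⟨⟨hd0, hdc⟩, hd⟩, hmax⟩ :=
    ((isCompact_Icc (a := (0 : V → ℝ)) (b := c)).inter_right hclosed).exists_isMaxOn
      ⟨0, ⟨le_rfl, hc⟩, by simpa using hb⟩
      (f := fun d => ∑ i, d i) (by fun_prop)
  exact ⟨d, ⟨hd0, hdc, hd⟩, fun e he0 hec he => hmax ⟨⟨he0, hec⟩, he⟩⟩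


/-- exchange lemma for polymatroids: let `r` be a normalized, monotone,
submodular set function on the finite ground set `Fin n`, and let
`P = {x ≥ 0 : ∀ S, x(S) ≤ r(S)}` be the associated polymatroid.  If `a ≥ 0`, `c ≥ 0`,
`a + c ∈ P`, `b ∈ P` and `a ≤ b`, then there is `d` with `0 ≤ d ≤ c`, `b + d ∈ P`, and
`‖c - d‖₁ ≤ ‖b - a‖₁`. -/
theorem stmt_7 (n : ℕ) (r : Finset (Fin n) → ℝ)
    (hr0 : r ∅ = 0)
    (hrmono : ∀ S T : Finset (Fin n), S ⊆ T → r S ≤ r T)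
    (hrsub : ∀ S T : Finset (Fin n), r (S ∪ T) + r (S ∩ T) ≤ r S + r T)
    (a b c : Fin n → ℝ)
    (ha : 0 ≤ a) (hc : 0 ≤ c)
    (hacP : (0 ≤ a + c) ∧ ∀ S : Finset (Fin n), ∑ i ∈ S, (a i + c i) ≤ r S)
    (hbP : (0 ≤ b) ∧ ∀ S : Finset (Fin n), ∑ i ∈ S, b i ≤ r S)
    (hab : a ≤ b) :
    ∃ d : Fin n → ℝ, 0 ≤ d ∧ d ≤ c ∧
      ((0 ≤ b + d) ∧ ∀ S : Finset (Fin n), ∑ i ∈ S, (b i + d i) ≤ r S) ∧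
      ∑ i, |c i - d i| ≤ ∑ i, |b i - a i| := by
  obtain ⟨d, ⟨hd0, hdc, hd⟩, hmax⟩ := exists_max_sum hc hbP.2
  refine ⟨d, hd0, hdc, ⟨add_nonneg hbP.1 hd0, hd⟩, ?_⟩
  have htight : ∀ j ∈ Finset.univ.filter (fun j => d j < c j),
      ∃ S, j ∈ S ∧ ∑ i ∈ S, (b i + d i) = r S := by
    intro j hj
    have hj : d j < c j := by simpa using hj
    by_contra! hno
    obtain ⟨ε, hε, hadd⟩ := exists_pos_add_single_le hd j hno
    have hδ : 0 < min ε (c j - d j) := lt_min hε (sub_pos.2 hj)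
    have hle := hmax (d + Pi.single j (min ε (c j - d j)))
      (add_nonneg hd0 (Pi.single_nonneg.2 hδ.le)) (fun i => ?_)
      (fun S => by simpa only [Pi.add_apply, add_assoc] using hadd _ (min_le_left _ _) S)
    · simp only [Pi.add_apply, Finset.sum_add_distrib, Finset.sum_pi_single', Finset.mem_univ,
        if_true] at hle
      linarith
    · rcases eq_or_ne i j with rfl | hij
      · simp only [Pi.add_apply, Pi.single_eq_same]
        linarith [min_le_right ε (c i - d i)]
      · simpa [hij] using hdc i
  obtain ⟨T, hJT, hT⟩ := exists_tight_superset hr0 hrsub hd _ htight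
  have hoff : ∀ i ∉ T, c i - d i = 0 := fun i hi =>
    sub_eq_zero.2 <| le_antisymm
      (not_lt.1 fun h => hi (hJT (by simpa using h))) (hdc i)
  have hac := hacP.2 T
  rw [Finset.sum_add_distrib] at hT hac
  calc ∑ i, |c i - d i| = ∑ i, (c i - d i) :=
        Finset.sum_congr rfl fun i _ => abs_of_nonneg (sub_nonneg.2 (hdc i))
    _ = ∑ i ∈ T, (c i - d i) :=
        (Finset.sum_subset T.subset_univ fun i _ hi => hoff i hi).symm
    _ ≤ ∑ i ∈ T, (b i - a i) := by
        rw [Finset.sum_sub_distrib, Finset.sum_sub_distrib]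
        linarith
    _ ≤ ∑ i, (b i - a i) :=
        Finset.sum_le_sum_of_subset_of_nonneg T.subset_univ
          fun i _ _ => sub_nonneg.2 (hab i)
    _ = ∑ i, |b i - a i| :=
        Finset.sum_congr rfl fun i _ => (abs_of_nonneg (sub_nonneg.2 (hab i))).symm
end

section
/- Let f : [0,1]^n → ℝ be differentiable, nonnegative, monotone (x ≤ y implies f(x) ≤ f(y)), and DR-submodular (its gradient is antitone). Let A ∈ ℝ^{m×n} have nonnegative entries, let η ≥ 0, η ≤ 1, and ε ∈ (0, 1]. Let x ∈ ℝ^n be nonnegative with (1+η)x ∈ [0,1]^n, and let x* ∈ [0,1]^n satisfy ‖Ax*‖_∞ ≤ 1 − ε. Let M be a real number with M ≤ f(x*) and suppose λ := M − (1+η)·f(x) > 0. Then there exists a coordinate i ∈ [n] such that ∇_i f((1+η)x) ≥ λ·(Aᵀ∇smax_η(Ax))_i. -/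
theorem fderiv_apply_eq_sum_fgrad {n : ℕ} (f : (Fin n → ℝ) → ℝ) (x v : Fin n → ℝ) :
    fderiv ℝ f x v = ∑ i, v i * fgrad f x i := by
  conv_lhs => rw [pi_eq_sum_univ' v]
  simp [map_sum, fgrad]

theorem exists_sub_eq_sum_fgrad {n : ℕ} {f : (Fin n → ℝ) → ℝ} (hf : Differentiable ℝ f)
    {u v : Fin n → ℝ} (huv : u ≤ v) :
    ∃ z, u ≤ z ∧ z ≤ v ∧ f v - f u = ∑ i, (v i - u i) * fgrad f z i := by
  obtain ⟨z, hz, h⟩ := domain_mvt (f := f) (s := Set.univ) (x := u) (y := v)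
    (f' := fun z => fderiv ℝ f z)
    (fun z _ => (hf z).hasFDerivAt.hasFDerivWithinAt) convex_univ trivial trivial
  have hz' := segment_subset_Icc huv hz
  refine ⟨z, hz'.1, hz'.2, ?_⟩
  rw [h, fderiv_apply_eq_sum_fgrad]
  rfl

/-- Along a nonnegative direction, the increment of a DR-submodular function lies between the
directional derivatives at the two endpoints. -/
theorem sub_mem_Icc_sum_fgrad {n : ℕ} {f : (Fin n → ℝ) → ℝ} (hf : Differentiable ℝ f)
    (hDR : ∀ x y : Fin n → ℝ, (∀ i, x i ∈ Set.Icc (0:ℝ) 1) →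
      (∀ i, y i ∈ Set.Icc (0:ℝ) 1) → x ≤ y → ∀ i, fgrad f y i ≤ fgrad f x i)
    {u v : Fin n → ℝ} (hu : ∀ i, u i ∈ Set.Icc (0:ℝ) 1) (hv : ∀ i, v i ∈ Set.Icc (0:ℝ) 1)
    (huv : u ≤ v) :
    f v - f u ∈ Set.Icc (∑ i, (v i - u i) * fgrad f v i) (∑ i, (v i - u i) * fgrad f u i) := by
  obtain ⟨z, huz, hzv, h⟩ := exists_sub_eq_sum_fgrad hf huv
  have hz : ∀ i, z i ∈ Set.Icc (0:ℝ) 1 := fun i =>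
    ⟨(hu i).1.trans (huz i), (hzv i).trans (hv i).2⟩
  rw [h]
  exact ⟨Finset.sum_le_sum fun i _ =>
      mul_le_mul_of_nonneg_left (hDR z v hz hv hzv i) (sub_nonneg.2 (huv i)),
    Finset.sum_le_sum fun i _ =>
      mul_le_mul_of_nonneg_left (hDR u z hu hz huz i) (sub_nonneg.2 (huv i))⟩

theorem sum_smaxGrad_le_one {m : ℕ} (η : ℝ) (z : Fin m → ℝ) : ∑ j, smaxGrad η z j ≤ 1 := by
  simp only [smaxGrad, ← Finset.sum_div]
  exact div_self_le_one _

/-- for a nonnegative, monotone, DR-submodular `f`, a nonnegative matrix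
`A`, a feasible point `x*` with `‖Ax*‖_∞ ≤ 1 - ε`, and `M ≤ f(x*)` with
`λ = M - (1+η) f(x) > 0`, there exists a coordinate `i` with
`∇_i f((1+η)x) ≥ λ (Aᵀ∇smax_η(Ax))_i`. -/
theorem stmt_11 (n m : ℕ) (f : (Fin n → ℝ) → ℝ) (hf : Differentiable ℝ f)
    (hnonneg : ∀ x : Fin n → ℝ, (∀ i, x i ∈ Set.Icc (0:ℝ) 1) → 0 ≤ f x)
    (hmono : ∀ x y : Fin n → ℝ, (∀ i, x i ∈ Set.Icc (0:ℝ) 1) →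
      (∀ i, y i ∈ Set.Icc (0:ℝ) 1) → x ≤ y → f x ≤ f y)
    (hDR : ∀ x y : Fin n → ℝ, (∀ i, x i ∈ Set.Icc (0:ℝ) 1) →
      (∀ i, y i ∈ Set.Icc (0:ℝ) 1) → x ≤ y → ∀ i, fgrad f y i ≤ fgrad f x i)
    (A : Matrix (Fin m) (Fin n) ℝ) (hA : ∀ j i, 0 ≤ A j i)
    (η ε : ℝ) (hη0 : 0 ≤ η) (hη1 : η ≤ 1) (hε0 : 0 < ε) (hε1 : ε ≤ 1)
    (x : Fin n → ℝ) (hx : 0 ≤ x)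
    (hbox : ∀ i, (1 + η) * x i ∈ Set.Icc (0:ℝ) 1)
    (xstar : Fin n → ℝ) (hxstar : ∀ i, xstar i ∈ Set.Icc (0:ℝ) 1)
    (hAxstar : ‖A.mulVec xstar‖ ≤ 1 - ε)
    (M : ℝ) (hM : M ≤ f xstar)
    (hlam : 0 < M - (1 + η) * f x) :
    ∃ i : Fin n,
      (M - (1 + η) * f x) * (∑ j, A j i * smaxGrad η (A.mulVec x) j) ≤
        fgrad f ((1 + η) • x) i := by
  have hy : ∀ i, ((1 + η) • x) i ∈ Set.Icc (0:ℝ) 1 := hbox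
  have hxy : x ≤ (1 + η) • x := fun i => by
    have := mul_nonneg hη0 (hx i)
    simp only [Pi.smul_apply, smul_eq_mul]
    linarith
  have hxb : ∀ i, x i ∈ Set.Icc (0:ℝ) 1 := fun i => ⟨hx i, (hxy i).trans (hy i).2⟩
  have h0b : ∀ i, (0 : Fin n → ℝ) i ∈ Set.Icc (0:ℝ) 1 := fun i => by simp
  have hfy : f ((1 + η) • x) ≤ (1 + η) * f x := by
    have h1 := (sub_mem_Icc_sum_fgrad hf hDR hxb hy hxy).2
    have h2 := (sub_mem_Icc_sum_fgrad hf hDR h0b hxb hx).1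
    have h3 : ∑ i, (((1 + η) • x) i - x i) * fgrad f x i =
        η * ∑ i, (x i - (0 : Fin n → ℝ) i) * fgrad f x i := by
      rw [Finset.mul_sum]
      refine Finset.sum_congr rfl fun i _ => ?_
      simp only [Pi.smul_apply, smul_eq_mul, Pi.zero_apply]
      ring
    have h4 := mul_le_mul_of_nonneg_left h2 hη0
    have h5 := mul_nonneg hη0 (hnonneg 0 h0b)
    linarith
  set y := (1 + η) • x
  set c := M - (1 + η) * f x with hc
  set g := smaxGrad η (A.mulVec x)
  have hwb : ∀ i, (xstar ⊔ y) i ∈ Set.Icc (0:ℝ) 1 := fun i =>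
    ⟨(hxstar i).1.trans le_sup_left, sup_le (hxstar i).2 (hy i).2⟩
  have hgain : c ≤ ∑ i, ((xstar ⊔ y) i - y i) * fgrad f y i := by
    have h1 := (sub_mem_Icc_sum_fgrad hf hDR hy hwb le_sup_right).2
    have h2 := hmono xstar (xstar ⊔ y) hxstar hwb le_sup_left
    linarith
  have hd0 : ∀ i, 0 ≤ (xstar ⊔ y) i - y i := fun i => sub_nonneg.2 le_sup_right
  have hd : ∀ i, (xstar ⊔ y) i - y i ≤ xstar i := fun i => by
    rw [sub_le_iff_le_add]
    exact sup_le (le_add_of_nonneg_right (hy i).1) (le_add_of_nonneg_left (hxstar i).1)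
  have hg0 : ∀ j, 0 ≤ g j := smaxGrad_nonneg η _
  have hcost : ∑ i, ((xstar ⊔ y) i - y i) * ∑ j, A j i * g j ≤ 1 - ε := by
    calc ∑ i, ((xstar ⊔ y) i - y i) * ∑ j, A j i * g j
        ≤ ∑ i, xstar i * ∑ j, A j i * g j := Finset.sum_le_sum fun i _ =>
          mul_le_mul_of_nonneg_right (hd i)
            (Finset.sum_nonneg fun j _ => mul_nonneg (hA j i) (hg0 j))
      _ = ∑ j, A.mulVec xstar j * g j := by
          simp only [Matrix.mulVec, dotProduct, Finset.mul_sum, Finset.sum_mul]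
          rw [Finset.sum_comm]
          exact Finset.sum_congr rfl fun j _ => Finset.sum_congr rfl fun i _ => by ring
      _ ≤ ∑ j, (1 - ε) * g j := Finset.sum_le_sum fun j _ =>
          mul_le_mul_of_nonneg_right
            (((le_abs_self _).trans (norm_le_pi_norm (A.mulVec xstar) j)).trans hAxstar) (hg0 j)
      _ ≤ 1 - ε := by
          rw [← Finset.mul_sum]
          exact mul_le_of_le_one_right (sub_nonneg.2 hε1) (sum_smaxGrad_le_one η _)
  by_contra! hlt
  have hle : ∑ i, ((xstar ⊔ y) i - y i) * fgrad f y i ≤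
      c * ∑ i, ((xstar ⊔ y) i - y i) * ∑ j, A j i * g j := by
    rw [Finset.mul_sum]
    refine Finset.sum_le_sum fun i _ => ?_
    rw [mul_left_comm]
    exact mul_le_mul_of_nonneg_left (hlt i).le (hd0 i)
  have h1 := mul_le_mul_of_nonneg_left hcost hlam.le
  have h2 := mul_pos hlam hε0
  linarith
end

section
/- Let t, t', u, u', M, ε be real numbers with 0 ≤ t ≤ t' ≤ 1, M ≥ 0, ε ≥ 0, 0 ≤ u ≤ u', and u' ≥ u + (M·(e^{−t} − 2ε) − u)·(t' − t). Then e^{t'}·u' ≥ (1 − 2eε)·(t' − t)·M + e^{t}·u, where e is Euler's number. -/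
/-- the per-iteration gain inequality of the non-monotone packing
algorithm: if `0 ≤ t ≤ t' ≤ 1`, `M ≥ 0`, `ε ≥ 0`, `0 ≤ u ≤ u'` and
`u' ≥ u + (M(e^{-t} - 2ε) - u)(t' - t)`, then
`e^{t'} u' ≥ (1 - 2eε)(t' - t)M + e^{t} u`. -/
theorem stmt_15 (t t' u u' M ε : ℝ)
    (ht0 : 0 ≤ t) (htt' : t ≤ t') (ht'1 : t' ≤ 1)
    (hM : 0 ≤ M) (hε : 0 ≤ ε)
    (hu : 0 ≤ u) (huu' : u ≤ u')
    (hgain : u + (M * (Real.exp (-t) - 2 * ε) - u) * (t' - t) ≤ u') :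
    (1 - 2 * Real.exp 1 * ε) * (t' - t) * M + Real.exp t * u ≤ Real.exp t' * u' := by
  have hd : 0 ≤ t' - t := sub_nonneg.2 htt'
  have het : Real.exp t ≤ Real.exp 1 := Real.exp_le_exp.2 (htt'.trans ht'1)
  have hinv : Real.exp t * Real.exp (-t) = 1 := by rw [← Real.exp_add]; simp
  have hstep : (1 + (t' - t)) * (Real.exp t * u') ≤ Real.exp t' * u' := by
    have hexp : Real.exp t' = Real.exp (t' - t) * Real.exp t := by
      rw [← Real.exp_add, sub_add_cancel]
    rw [hexp, mul_assoc]
    have := Real.add_one_le_exp (t' - t)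
    have hu' : 0 ≤ u' := hu.trans huu'
    gcongr
    linarith
  have hP : (1 - 2 * Real.exp 1 * ε) * (t' - t) * M
      ≤ M * (1 - 2 * ε * Real.exp t) * (t' - t) := by
    have := mul_le_mul_of_nonneg_left het (mul_nonneg (mul_nonneg hε hd) hM)
    linarith
  have hmono : Real.exp t * u ≤ Real.exp t * u' := by gcongr
  have hscaled : Real.exp t * u + (M * (1 - 2 * ε * Real.exp t) - Real.exp t * u) * (t' - t)
      ≤ Real.exp t * u' := by
    have := mul_le_mul_of_nonneg_left hgain (Real.exp_pos t).le
    linear_combination this - M * (t' - t) * hinv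
  have hd' := mul_le_mul_of_nonneg_left hmono hd
  linarith
end

section
/- Let ε ∈ [0, 1], let x ∈ [0, 1], let z ≥ 0, and let d ∈ [0, ε]. Suppose x·e^z ≤ (1 + ε)·(e^z − 1). Set x' = x + d·(1 − x) and z' = z + d. Then x'·e^{z'} ≤ (1 + ε)·(e^{z'} − 1). -/
/-- the inductive step of the invariant `x ≤ (1+ε)(1 - e^{-z})` of the
non-monotone packing algorithm: if `x e^z ≤ (1+ε)(e^z - 1)`, `x ∈ [0,1]`, `z ≥ 0`,
`d ∈ [0, ε]`, `ε ∈ [0,1]`, then with `x' = x + d(1-x)` and `z' = z + d` we have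
`x' e^{z'} ≤ (1+ε)(e^{z'} - 1)`. -/
theorem stmt_16 (ε x z d : ℝ)
    (hε : ε ∈ Set.Icc (0:ℝ) 1) (hx : x ∈ Set.Icc (0:ℝ) 1)
    (hz : 0 ≤ z) (hd : d ∈ Set.Icc 0 ε)
    (hinv : x * Real.exp z ≤ (1 + ε) * (Real.exp z - 1)) :
    (x + d * (1 - x)) * Real.exp (z + d) ≤ (1 + ε) * (Real.exp (z + d) - 1) := by
  obtain ⟨hε0, hε1⟩ := hε
  obtain ⟨hd0, hdε⟩ := hd
  rw [Real.exp_add]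
  have hE : 1 ≤ Real.exp z := Real.one_le_exp hz
  have hD : d + 1 ≤ Real.exp d := Real.add_one_le_exp d
  have hD0 : 0 < Real.exp d := Real.exp_pos d
  generalize Real.exp z = E at *
  generalize Real.exp d = D at *
  have hstep : (1 - d) * D * (x * E) ≤ (1 - d) * D * ((1 + ε) * (E - 1)) :=
    mul_le_mul_of_nonneg_left hinv (mul_nonneg (by linarith) hD0.le)
  have hgrow : 0 ≤ ε * d * D * (E - 1) :=
    mul_nonneg (by positivity) (by linarith)
  have hbase : 0 ≤ (D - (d + 1)) * (1 + ε - d) :=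
    mul_nonneg (by linarith) (by linarith)
  have hquad : 0 ≤ d * (ε - d) := mul_nonneg hd0 (by linarith)
  linarith
end

section
/- Let η ∈ (0, 1], ε ∈ (0, 1/2], and let n ≥ 1 be an integer. Let x_1, ..., x_{T+1} ∈ (0, 1) and m_1, ..., m_T ∈ [0, 1] satisfy x_{j+1} = x_j + η·m_j·x_j·(1 − x_j) for all j, with x_1 ≥ ε²/n² and x_{T+1} ≤ 1 − ε. Then Σ_{j=1}^T m_j ≤ (10/η)·ln(n/ε). -/
/-- One step of size `a` of the discretized logistic equation increases the logit by at least
`a / 2`. -/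
theorem half_le_logit_step_sub {a x : ℝ} (ha0 : 0 ≤ a) (ha1 : a ≤ 1) (hx0 : 0 < x)
    (hx1 : x < 1) :
    a / 2 ≤ (Real.log (x + a * x * (1 - x)) - Real.log (1 - (x + a * x * (1 - x)))) -
      (Real.log x - Real.log (1 - x)) := by
  have hz : 0 ≤ a * (1 - x) := mul_nonneg ha0 (by linarith)
  have hz1 : a * (1 - x) ≤ 1 := by nlinarith
  have hp : 0 < 1 + a * (1 - x) := by linarith
  have hq : 0 < 1 - a * x := by nlinarith
  have e1 : x + a * x * (1 - x) = x * (1 + a * (1 - x)) := by ring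
  have e2 : 1 - x * (1 + a * (1 - x)) = (1 - x) * (1 - a * x) := by ring
  rw [e1, e2, Real.log_mul hx0.ne' hp.ne', Real.log_mul (by linarith) hq.ne']
  have hlog_add : a * (1 - x) / 2 ≤ Real.log (1 + a * (1 - x)) := by
    refine le_trans ?_ (Real.one_sub_inv_le_log_of_pos hp)
    rw [le_sub_iff_add_le, ← le_sub_iff_add_le', inv_le_iff_one_le_mul₀ hp]
    nlinarith
  have hlog_sub := Real.log_le_sub_one_of_pos hq
  nlinarith [mul_nonneg ha0 hx0.le]

/-- a sequence in `(0,1)` evolving by `x_{j+1} = x_j + η m_j x_j (1 - x_j)`,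
starting at least `ε²/n²` and ending at most `1 - ε`, satisfies
`∑_j m_j ≤ (10/η) ln(n/ε)`. -/
theorem stmt_17 (η ε : ℝ) (hη0 : 0 < η) (hη1 : η ≤ 1) (hε0 : 0 < ε) (hε1 : ε ≤ 1 / 2)
    (n : ℕ) (hn : 1 ≤ n) (T : ℕ)
    (x : Fin (T + 1) → ℝ) (m : Fin T → ℝ)
    (hxmem : ∀ j, x j ∈ Set.Ioo (0:ℝ) 1)
    (hm : ∀ j, m j ∈ Set.Icc (0:ℝ) 1)
    (hrec : ∀ j : Fin T, x j.succ = x j.castSucc + η * m j * x j.castSucc * (1 - x j.castSucc))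
    (hx0 : ε ^ 2 / n ^ 2 ≤ x 0)
    (hxT : x (Fin.last T) ≤ 1 - ε) :
    ∑ j, m j ≤ (10 / η) * Real.log (n / ε) := by
  have hn' : (1 : ℝ) ≤ n := by exact_mod_cast hn
  have hn0 : (0 : ℝ) < n := by linarith
  set f : Fin (T + 1) → ℝ := fun j => Real.log (x j) - Real.log (1 - x j) with hf
  have hstep : ∀ j : Fin T, η * m j / 2 ≤ f j.succ - f j.castSucc := by
    intro j
    simp only [hf, hrec j]
    exact half_le_logit_step_sub (mul_nonneg hη0.le (hm j).1)
      (mul_le_one₀ hη1 (hm j).1 (hm j).2) (hxmem _).1 (hxmem _).2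
  have hsum : ∑ j, η * m j / 2 ≤ f (Fin.last T) - f 0 := by
    refine (Finset.sum_le_sum fun j _ => hstep j).trans_eq ?_
    rw [Finset.sum_sub_distrib]
    linarith [Fin.sum_univ_succ f, Fin.sum_univ_castSucc f]
  rw [← Finset.sum_div, ← Finset.mul_sum] at hsum
  have hlast : f (Fin.last T) ≤ -Real.log ε := by
    have h1 := Real.log_nonpos (hxmem (Fin.last T)).1.le (hxmem (Fin.last T)).2.le
    have h2 := Real.log_le_log hε0 (show ε ≤ 1 - x (Fin.last T) by linarith)
    simp only [hf]
    linarith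
  have hfirst : 2 * Real.log ε - 2 * Real.log n ≤ f 0 := by
    have h1 := Real.log_le_log (by positivity) hx0
    rw [Real.log_div (by positivity) (by positivity), Real.log_pow, Real.log_pow] at h1
    have h2 := Real.log_nonpos (x := 1 - x 0) (by linarith [(hxmem 0).2])
      (by linarith [(hxmem 0).1])
    simp only [hf]
    push_cast at h1
    linarith
  have hlogn := Real.log_nonneg hn'
  have hlogε := Real.log_nonpos hε0.le (by linarith)
  rw [div_mul_eq_mul_div, le_div_iff₀ hη0, Real.log_div hn0.ne' hε0.ne']
  linarith
end

section
/- Let η > 0 and let z, d ∈ ℝ^m be nonnegative vectors. Then for every coordinate j ∈ [m], ∇_j smax_η(z + d) ≤ e^{‖d‖_∞/η} · ∇_j smax_η(z), where ‖d‖_∞ = max_j d_j. -/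
/-- for `η > 0` and nonnegative vectors `z, d ∈ ℝ^m`, for every
coordinate `j`, `∇_j smax_η(z + d) ≤ e^{‖d‖_∞/η} ∇_j smax_η(z)`.  The norm on
`Fin m → ℝ` is the sup norm. -/
theorem stmt_18 (m : ℕ) (η : ℝ) (hη : 0 < η)
    (z d : Fin m → ℝ) (hz : 0 ≤ z) (hd : 0 ≤ d) (j : Fin m) :
    smaxGrad η (z + d) j ≤ Real.exp (‖d‖ / η) * smaxGrad η z j := by
  have hdj : d j ≤ ‖d‖ := (le_abs_self _).trans (norm_le_pi_norm d j)
  have hpos : 0 < ∑ l, Real.exp (z l / η) :=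
    Finset.sum_pos (fun l _ => Real.exp_pos _) ⟨j, Finset.mem_univ j⟩
  unfold smaxGrad
  rw [← mul_div_assoc, ← Real.exp_add, ← add_div, Pi.add_apply, add_comm (z j)]
  gcongr with l
  exact le_add_of_nonneg_right (hd l)
end
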